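/- Let f : ℝ → ℂ be a smooth function whose support is a compact subset of (0, ∞), and let K be a compact subset of (0, ∞). Then there exist constants C > 0 and α₀ > 0 (depending only on f and K) such that for all real α ≥ α₀ and all real β with β/α ∈ K, one has | ∫₀^∞ f(y) e(α y^{1/2} − β y^{1/3}) dy − 6 (2β/(3α))^5 (2β)^{−1/2} e( −4β³/(27α²) + 1/8 ) · f( (2β/(3α))^6 ) | ≤ C α^{−3/2}. -/

import Mathlib

open MeasureTheory

/-- `e x = exp(2πix)`. -/
noncomputable def e (x : ℝ) : ℂ := Complex.exp (2 * Real.pi * Complex.I * x)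

open FourierTransform SchwartzMap Filter Topology

lemma continuousWithinAt_integral_gaussian {G : ℝ → ℂ} (hG : Integrable G) (b₀ : ℂ) :
    ContinuousWithinAt (fun b : ℂ => ∫ u : ℝ, Complex.exp (-Real.pi * b * u ^ 2) * G u)
      {b | 0 ≤ b.re} b₀ := by
  apply continuousWithinAt_of_dominated (bound := fun u => ‖G u‖)
  · filter_upwards with b
    exact (Continuous.aestronglyMeasurable (by fun_prop)).mul hG.1
  · filter_upwards [self_mem_nhdsWithin] with b hb
    filter_upwards with u
    rw [norm_mul, Complex.norm_exp]
    refine mul_le_of_le_one_left (norm_nonneg _) (Real.exp_le_one_iff.2 ?_)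
    have : (-Real.pi * b * (u : ℂ) ^ 2).re = -(Real.pi * u ^ 2 * b.re) := by
      rw [show -Real.pi * b * (u : ℂ) ^ 2 = ((-Real.pi * u ^ 2 : ℝ) : ℂ) * b by push_cast; ring,
        Complex.re_ofReal_mul]
      ring
    rw [this, neg_nonpos]
    have := Real.pi_pos
    have : 0 ≤ b.re := hb
    positivity
  · exact hG.norm
  · filter_upwards with u
    exact Continuous.continuousWithinAt (by fun_prop)

lemma integral_gaussian_mul_fourier_of_re_pos (H : 𝓢(ℝ, ℂ)) {b : ℂ} (hb : 0 < b.re) :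
    ∫ u : ℝ, Complex.exp (-Real.pi * b * u ^ 2) * 𝓕 H u =
      1 / b ^ (1 / 2 : ℂ) * ∫ x : ℝ, Complex.exp (-Real.pi * b⁻¹ * x ^ 2) * H x := by
  have hg : Integrable (fun x : ℝ => Complex.exp (-Real.pi * b * x ^ 2)) := by
    have := integrable_cexp_neg_mul_sq (b := Real.pi * b)
      (by rw [Complex.re_ofReal_mul]; positivity)
    simpa [neg_mul] using this
  have key := VectorFourier.integral_fourierIntegral_smul_eq_flip (L := innerₗ ℝ)
    (μ := volume) (ν := volume) Real.continuous_fourierChar continuous_inner hg H.integrable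
  have hF := fourier_gaussian_pi hb
  have h1 : ∀ x, VectorFourier.fourierIntegral Real.fourierChar volume (innerₗ ℝ)
      (fun x : ℝ => Complex.exp (-Real.pi * b * x ^ 2)) x =
      1 / b ^ (1 / 2 : ℂ) * Complex.exp (-Real.pi / b * x ^ 2) := fun x => congrFun hF x
  rw [flip_innerₗ] at key
  simp only [h1, smul_eq_mul] at key
  rw [← integral_const_mul]
  refine Eq.trans key.symm (integral_congr_ae (Eventually.of_forall fun x => ?_))
  simp only [div_eq_mul_inv, mul_assoc]

lemma e_eq_exp (x : ℝ) : e x = Complex.exp ((2 * Real.pi * x : ℝ) * Complex.I) := by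
  unfold e; congr 1; push_cast; ring

lemma norm_e (x : ℝ) : ‖e x‖ = 1 := by
  rw [e_eq_exp, Complex.norm_exp_ofReal_mul_I]

lemma e_add (x y : ℝ) : e (x + y) = e x * e y := by
  unfold e; rw [← Complex.exp_add]; congr 1; push_cast; ring

lemma norm_e_sub_one_le (x : ℝ) : ‖e x - 1‖ ≤ 2 * Real.pi * |x| := by
  rw [e_eq_exp, mul_comm]
  refine Real.norm_exp_I_mul_ofReal_sub_one_le.trans (le_of_eq ?_)
  rw [Real.norm_eq_abs, abs_mul, abs_of_pos Real.two_pi_pos]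

lemma integral_e_mul_fourier (H : 𝓢(ℝ, ℂ)) {m : ℝ} (hm : 0 < m) :
    ∫ u : ℝ, e (m * u ^ 2) * 𝓕 H u =
      e (1 / 8) / Real.sqrt (2 * m) * ∫ x : ℝ, e (-x ^ 2 / (4 * m)) * H x := by
  set b₀ : ℂ := -(2 * m) * Complex.I with hb₀
  have hb0 : b₀ ≠ 0 := by simp [hb₀, hm.ne']
  have hre : b₀.re = 0 := by simp [hb₀]
  have hcl : b₀ ∈ closure {b : ℂ | 0 < b.re} := by
    rw [Complex.closure_setOfPred_lt_re]; exact hre.ge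
  have : (𝓝[{b : ℂ | 0 < b.re}] b₀).NeBot := mem_closure_iff_nhdsWithin_neBot.1 hcl
  have hsub : {b : ℂ | 0 < b.re} ⊆ {b | 0 ≤ b.re} := fun b (hb : 0 < b.re) => hb.le
  have hL := ((continuousWithinAt_integral_gaussian (𝓕 H).integrable b₀).mono hsub).tendsto
  have hslit : b₀ ∈ Complex.slitPlane := by
    right; simp [hb₀, hm.ne']
  have hR1 : Tendsto (fun b : ℂ => ∫ x : ℝ, Complex.exp (-Real.pi * b⁻¹ * x ^ 2) * H x)
      (𝓝[{b : ℂ | 0 < b.re}] b₀)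
      (𝓝 (∫ x : ℝ, Complex.exp (-Real.pi * b₀⁻¹ * x ^ 2) * H x)) := by
    refine (continuousWithinAt_integral_gaussian H.integrable b₀⁻¹).tendsto.comp ?_
    refine tendsto_nhdsWithin_of_tendsto_nhds_of_eventually_within _
      ((continuousAt_inv₀ hb0).tendsto.mono_left nhdsWithin_le_nhds) ?_
    filter_upwards [self_mem_nhdsWithin] with b hb
    have : 0 < b.re := hb
    change 0 ≤ (b⁻¹).re
    rw [Complex.inv_re]
    exact div_nonneg this.le (Complex.normSq_nonneg _)
  have hR2 : Tendsto (fun b : ℂ => 1 / b ^ (1 / 2 : ℂ)) (𝓝[{b : ℂ | 0 < b.re}] b₀)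
      (𝓝 (1 / b₀ ^ (1 / 2 : ℂ))) := by
    refine Tendsto.mono_left ?_ nhdsWithin_le_nhds
    refine tendsto_const_nhds.div ?_ (by simp [Complex.cpow_eq_zero_iff, hb0])
    exact (continuousAt_cpow_const hslit).tendsto
  have hEq := tendsto_nhds_unique_of_eventuallyEq hL (hR2.mul hR1) (by
    filter_upwards [self_mem_nhdsWithin] with b hb
    exact integral_gaussian_mul_fourier_of_re_pos H hb)
  have hc : 1 / b₀ ^ (1 / 2 : ℂ) = e (1 / 8) / Real.sqrt (2 * m) := by
    have hlog : Complex.log b₀ = Real.log (2 * m) - Real.pi / 2 * Complex.I := by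
      rw [hb₀, show -(2 * (m : ℂ)) * Complex.I = ((2 * m : ℝ) : ℂ) * (-Complex.I) by
        push_cast; ring, Complex.log_ofReal_mul (by positivity) (by simp), Complex.log_neg_I]
      ring
    have hs : (Real.sqrt (2 * m) : ℂ) = Complex.exp (Real.log (2 * m) / 2) := by
      rw [Real.sqrt_eq_rpow, Real.rpow_def_of_pos (by positivity)]
      push_cast; congr 1; ring
    rw [Complex.cpow_def_of_ne_zero hb0, hlog, hs, e, ← Complex.exp_sub, one_div,
      ← Complex.exp_neg]
    congr 1; push_cast; ring
  rw [hc] at hEq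
  have hm' : (m : ℂ) ≠ 0 := by exact_mod_cast hm.ne'
  have hI := Complex.I_ne_zero
  have h1 : ∀ u : ℝ, e (m * u ^ 2) = Complex.exp (-Real.pi * b₀ * u ^ 2) := fun u => by
    rw [e, hb₀]; congr 1; push_cast; ring
  have h2 : ∀ x : ℝ, e (-x ^ 2 / (4 * m)) = Complex.exp (-Real.pi * b₀⁻¹ * x ^ 2) := fun x => by
    have hinv : b₀⁻¹ = Complex.I / (2 * m) := by
      rw [inv_eq_iff_eq_inv, hb₀, inv_div, eq_div_iff hI]
      linear_combination (-2 * (m : ℂ)) * Complex.I_sq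
    rw [e, hinv]; congr 1; push_cast; field_simp; ring
  simpa only [h1, h2] using hEq

lemma norm_integral_e_mul_fourier_sub_le (H : 𝓢(ℝ, ℂ)) {m : ℝ} (hm : 0 < m) :
    ‖(∫ u : ℝ, e (m * u ^ 2) * 𝓕 H u) - e (1 / 8) / Real.sqrt (2 * m) * 𝓕 H 0‖ ≤
      1 / Real.sqrt (2 * m) * (Real.pi / (2 * m) * ∫ x : ℝ, ‖x ^ 2 * H x‖) := by
  have h0 : 𝓕 H 0 = ∫ x, H x := by
    rw [SchwartzMap.fourier_coe, Real.fourier_eq]; simp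
  have hint : Integrable fun x : ℝ => e (-x ^ 2 / (4 * m)) * H x := by
    refine H.integrable.bdd_mul (c := 1) ?_ (Eventually.of_forall fun x => (norm_e _).le)
    exact Continuous.aestronglyMeasurable (by unfold e; fun_prop)
  rw [integral_e_mul_fourier H hm, h0, ← mul_sub, ← integral_sub hint H.integrable, norm_mul,
    norm_div, norm_e, Complex.norm_real, Real.norm_of_nonneg (Real.sqrt_nonneg _),
    ← integral_const_mul]
  gcongr
  refine norm_integral_le_of_norm_le ?_ (Eventually.of_forall fun x => ?_)
  · refine Integrable.const_mul ?_ _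
    refine (H.integrable_pow_mul volume 2).congr (Eventually.of_forall fun x => ?_)
    simp
  · rw [← sub_one_mul, norm_mul, norm_mul]
    refine (mul_le_mul_of_nonneg_right (norm_e_sub_one_le _) (norm_nonneg _)).trans (le_of_eq ?_)
    rw [abs_div, abs_neg, abs_of_pos (show 0 < 4 * m by positivity), norm_pow, Complex.norm_real,
      Real.norm_eq_abs, abs_pow]
    field_simp
    ring

open scoped ContDiff

lemma iteratedDeriv_eq_zero_of_notMem {G : ℝ → ℂ} {s : Set ℝ} (hs : IsClosed s)
    (hG : ∀ u ∉ s, G u = 0) (n : ℕ) {u : ℝ} (hu : u ∉ s) : iteratedDeriv n G u = 0 := by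
  have : G =ᶠ[𝓝 u] fun _ => 0 := by
    filter_upwards [hs.isOpen_compl.mem_nhds hu] with x hx using hG x hx
  rw [this.iteratedDeriv_eq, iteratedDeriv_const]
  simp

lemma norm_integral_e_mul_sub_le {G : ℝ → ℂ} (hG : ContDiff ℝ ∞ G) {R M : ℝ} (hR : 0 ≤ R)
    (hsupp : ∀ u ∉ Set.Icc (-R) R, G u = 0)
    (h2 : ∀ u, ‖iteratedDeriv 2 G u‖ ≤ M) (h4 : ∀ u, ‖iteratedDeriv 4 G u‖ ≤ M)
    {m : ℝ} (hm : 0 < m) :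
    ‖(∫ u : ℝ, e (m * u ^ 2) * G u) - e (1 / 8) / Real.sqrt (2 * m) * G 0‖ ≤
      1 / Real.sqrt (2 * m) * (Real.pi / (2 * m) * (4 * R * M * Real.pi)) := by
  have hc : HasCompactSupport G := HasCompactSupport.intro isCompact_Icc hsupp
  set g : 𝓢(ℝ, ℂ) := hc.toSchwartzMap hG with hg
  have hgG : (g : ℝ → ℂ) = G := rfl
  have hM : 0 ≤ M := (norm_nonneg _).trans (h2 0)
  have hint : ∀ n : ℕ, Integrable (iteratedDeriv n G) := fun n =>
    (hG.continuous_iteratedDeriv n (by exact_mod_cast le_top)).integrable_of_hasCompactSupport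
      (HasCompactSupport.intro isCompact_Icc
        fun u hu => iteratedDeriv_eq_zero_of_notMem isClosed_Icc hsupp n hu)
  have hL1 : ∀ n : ℕ, (∀ u, ‖iteratedDeriv n G u‖ ≤ M) → ∀ x : ℝ,
      |x| ^ n * ‖𝓕 G x‖ ≤ 2 * R * M := by
    intro n hn x
    have hF := congrFun (Real.fourier_iteratedDeriv (N := ⊤) (n := n) hG (fun k _ => hint k)
      le_top) x
    have hle : ‖𝓕 (iteratedDeriv n G) x‖ ≤ 2 * R * M := by
      have h0 : 𝓕 (iteratedDeriv n G) x = ∫ u in Set.Icc (-R) R,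
          Real.fourierChar (-(u * x)) • iteratedDeriv n G u := by
        rw [Real.fourier_real_eq, setIntegral_eq_integral_of_forall_compl_eq_zero]
        intro u hu
        rw [iteratedDeriv_eq_zero_of_notMem isClosed_Icc hsupp n hu, smul_zero]
      rw [h0]
      refine (norm_setIntegral_le_of_norm_le_const (C := M) (by simp)
        fun u _ => ?_).trans (le_of_eq ?_)
      · rw [Circle.norm_smul]; exact hn u
      · rw [Real.volume_real_Icc_of_le (by linarith)]; ring
    rw [hF, norm_smul, norm_pow] at hle
    refine le_trans (mul_le_mul_of_nonneg_right (pow_le_pow_left₀ (abs_nonneg _) ?_ n)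
      (norm_nonneg _)) hle
    have hn : ‖2 * (Real.pi : ℂ) * Complex.I * x‖ = 2 * Real.pi * |x| := by
      simp [abs_of_pos Real.pi_pos]
    rw [hn]
    nlinarith [Real.pi_gt_three, abs_nonneg x]
  set H : 𝓢(ℝ, ℂ) := 𝓕⁻ g with hH
  have hFH : ∀ u, 𝓕 H u = G u := fun u => by
    rw [hH, fourier_fourierInv_eq, hgG]
  have hHn : ∀ x, H x = 𝓕 G (-x) := fun x => by
    rw [hH, SchwartzMap.fourierInv_coe, hgG, Real.fourierInv_eq_fourier_neg]
  have key := norm_integral_e_mul_fourier_sub_le H hm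
  simp only [hFH] at key
  refine key.trans ?_
  gcongr
  rw [← integral_univ_inv_one_add_sq, ← integral_const_mul]
  refine integral_mono ?_ (integrable_inv_one_add_sq.const_mul _) fun x => ?_
  · refine (H.integrable_pow_mul volume 2).congr (Eventually.of_forall fun x => ?_)
    simp
  · have e2 := hL1 2 h2 (-x)
    have e4 := hL1 4 h4 (-x)
    rw [abs_neg] at e2 e4
    rw [← div_eq_mul_inv, le_div_iff₀ (by positivity), norm_mul, norm_pow, Complex.norm_real,
      Real.norm_eq_abs, hHn]
    have : |x| ^ 2 = x ^ 2 := sq_abs x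
    have h4' : |x| ^ 4 = x ^ 2 * x ^ 2 := by rw [← this]; ring
    rw [h4'] at e4
    rw [this] at e2 ⊢
    linarith

lemma exists_contDiff_iteratedDeriv_eq {F : ℝ × ℝ → ℂ} (hF : ContDiff ℝ ∞ F) (n : ℕ) :
    ∃ F' : ℝ × ℝ → ℂ, ContDiff ℝ ∞ F' ∧
      ∀ x u, iteratedDeriv n (fun u => F (x, u)) u = F' (x, u) := by
  induction n with
  | zero => exact ⟨F, hF, fun x u => by simp⟩
  | succ n ih =>
    obtain ⟨F', hF', h⟩ := ih
    refine ⟨fun p => fderiv ℝ F' p (0, 1),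
      (hF'.fderiv_right (m := ∞) (by simp)).clm_apply contDiff_const, fun x u => ?_⟩
    rw [iteratedDeriv_succ, funext (h x)]
    have h1 : HasDerivAt (fun u : ℝ => (x, u)) (0, 1) u :=
      (hasDerivAt_const u x).prodMk (hasDerivAt_id u)
    have h2 := (hF'.differentiable (by simp) (x, u)).hasFDerivAt
    exact (h2.comp_hasDerivAt u h1).deriv

lemma exists_forall_norm_integral_e_mul_sub_le {F : ℝ × ℝ → ℂ} (hF : ContDiff ℝ ∞ F)
    {L Q : Set ℝ} (hL : IsCompact L) (hQ : IsCompact Q)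
    (hsupp : ∀ x ∈ L, ∀ u ∉ Q, F (x, u) = 0) :
    ∃ C : ℝ, ∀ x ∈ L, ∀ m : ℝ, 0 < m →
      ‖(∫ u : ℝ, e (m * u ^ 2) * F (x, u)) - e (1 / 8) / Real.sqrt (2 * m) * F (x, 0)‖ ≤
        C * m ^ (-(3 : ℝ) / 2) := by
  have hbdd : ∀ n : ℕ, ∃ M, ∀ x ∈ L, ∀ u, ‖iteratedDeriv n (fun u => F (x, u)) u‖ ≤ M := by
    intro n
    obtain ⟨F', hF', h⟩ := exists_contDiff_iteratedDeriv_eq hF n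
    obtain ⟨M, hM⟩ := (hL.prod hQ).exists_bound_of_continuousOn hF'.continuous.continuousOn
    refine ⟨max M 0, fun x hx u => ?_⟩
    by_cases hu : u ∈ Q
    · rw [h]; exact (hM (x, u) ⟨hx, hu⟩).trans (le_max_left _ _)
    · rw [iteratedDeriv_eq_zero_of_notMem hQ.isClosed (hsupp x hx) n hu, norm_zero]
      exact le_max_right _ _
  obtain ⟨M₂, hM₂⟩ := hbdd 2
  obtain ⟨M₄, hM₄⟩ := hbdd 4
  obtain ⟨R, hR⟩ := hQ.isBounded.subset_closedBall 0
  rw [Real.closedBall_eq_Icc, zero_sub, zero_add] at hR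
  refine ⟨1 / Real.sqrt 2 * (Real.pi / 2 * (4 * max R 0 * max M₂ M₄ * Real.pi)),
    fun x hx m hm => ?_⟩
  have hsub : Q ⊆ Set.Icc (-max R 0) (max R 0) := hR.trans
    (Set.Icc_subset_Icc (neg_le_neg (le_max_left _ _)) (le_max_left _ _))
  refine (norm_integral_e_mul_sub_le (G := fun u => F (x, u)) (by fun_prop) (le_max_right R 0)
    (fun u hu => hsupp x hx u fun h => hu (hsub h))
    (fun u => (hM₂ x hx u).trans (le_max_left M₂ M₄))
    (fun u => (hM₄ x hx u).trans (le_max_right M₂ M₄)) hm).trans (le_of_eq ?_)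
  have hpow : m ^ (-(3 : ℝ) / 2) = (Real.sqrt m)⁻¹ * m⁻¹ := by
    rw [Real.sqrt_eq_rpow, ← Real.rpow_neg hm.le, ← Real.rpow_neg_one m, ← Real.rpow_add hm]
    norm_num
  rw [hpow, Real.sqrt_mul zero_le_two]
  field_simp

lemma contDiffAt_of_leftInvOn {v r : ℝ → ℝ} {s : Set ℝ} (hs : IsOpen s)
    (hr : Set.LeftInvOn r v s) {w v' : ℝ} (hw : w ∈ s) (hv : ContDiffAt ℝ ∞ v w)
    (hv' : HasDerivAt v v' w) (h0 : v' ≠ 0) : ContDiffAt ℝ ∞ r (v w) := by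
  have hstrict : HasStrictDerivAt v v' w := by
    have := hv.hasStrictDerivAt (by simp)
    rwa [hv'.deriv] at this
  have hfd : HasFDerivAt v
      (ContinuousLinearEquiv.unitsEquivAut ℝ (Units.mk0 v' h0) : ℝ →L[ℝ] ℝ) w := hv'.hasFDerivAt
  refine (hv.to_localInverse hfd (by simp)).congr_of_eventuallyEq ?_
  rw [EventuallyEq, ← hstrict.map_nhds_eq h0, eventually_map]
  filter_upwards [hs.mem_nhds hw, (hv.hasStrictFDerivAt' hfd (by simp)).eventually_left_inverse]
    with x hx hx'
  exact (hr hx).trans hx'.symm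

/-- The Morse coordinate of `w ^ 3 - w ^ 2` at its critical point `2 / 3`:
`cubicMorse w ^ 2 = w ^ 3 - w ^ 2 + 4 / 27`. -/
noncomputable def cubicMorse (w : ℝ) : ℝ := (w - 2 / 3) * Real.sqrt (w + 1 / 3)

lemma cubicMorse_sq {w : ℝ} (hw : 0 < w) : cubicMorse w ^ 2 = w ^ 3 - w ^ 2 + 4 / 27 := by
  rw [cubicMorse, mul_pow, Real.sq_sqrt (by positivity)]
  ring

lemma hasDerivAt_cubicMorse {w : ℝ} (hw : 0 < w) :
    HasDerivAt cubicMorse (3 * w / (2 * Real.sqrt (w + 1 / 3))) w := by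
  have h := ((hasDerivAt_id w).sub_const (2 / 3)).mul
    (((hasDerivAt_id w).add_const (1 / 3)).sqrt (by simp; positivity))
  refine HasDerivAt.congr_deriv h ?_
  have hs : Real.sqrt (w + 1 / 3) ^ 2 = w + 1 / 3 := Real.sq_sqrt (by positivity)
  have hs0 : Real.sqrt (w + 1 / 3) ≠ 0 := (Real.sqrt_pos.2 (by positivity)).ne'
  simp only [id]
  generalize Real.sqrt (w + 1 / 3) = s at hs hs0
  field_simp
  linear_combination 6 * hs

lemma deriv_cubicMorse_pos {w : ℝ} (hw : 0 < w) : 0 < 3 * w / (2 * Real.sqrt (w + 1 / 3)) := by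
  positivity

lemma contDiffAt_cubicMorse {w : ℝ} (hw : 0 < w) : ContDiffAt ℝ ∞ cubicMorse w :=
  (contDiffAt_id.sub contDiffAt_const).mul
    ((contDiffAt_id.add contDiffAt_const).sqrt (by simp; positivity))

lemma injOn_cubicMorse : Set.InjOn cubicMorse (Set.Ioi 0) := by
  refine (strictMonoOn_of_deriv_pos (convex_Ioi 0)
    (fun w hw => (contDiffAt_cubicMorse hw).continuousAt.continuousWithinAt) fun w hw => ?_).injOn
  rw [interior_Ioi] at hw
  rw [(hasDerivAt_cubicMorse hw).deriv]
  exact deriv_cubicMorse_pos hw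

open Classical in
/-- The inverse of `cubicMorse` on `(0, ∞)`, extended by `0`. -/
noncomputable def cubicMorseInv (u : ℝ) : ℝ :=
  if u ∈ cubicMorse '' Set.Ioi 0 then Function.invFunOn cubicMorse (Set.Ioi 0) u else 0

lemma cubicMorseInv_leftInvOn : Set.LeftInvOn cubicMorseInv cubicMorse (Set.Ioi 0) := by
  intro w hw
  rw [cubicMorseInv, if_pos ⟨w, hw, rfl⟩]
  exact injOn_cubicMorse.leftInvOn_invFunOn hw

lemma contDiffAt_cubicMorseInv {w : ℝ} (hw : 0 < w) :
    ContDiffAt ℝ ∞ cubicMorseInv (cubicMorse w) :=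
  contDiffAt_of_leftInvOn isOpen_Ioi cubicMorseInv_leftInvOn hw (contDiffAt_cubicMorse hw)
    (hasDerivAt_cubicMorse hw) (deriv_cubicMorse_pos hw).ne'

/-- The amplitude obtained from `f` by the substitution `y = (exp x * w) ^ 6`, `u = cubicMorse w`. -/
noncomputable def morseAmplitude (f : ℝ → ℂ) (p : ℝ × ℝ) : ℂ :=
  ((4 * Real.exp p.1 ^ 6 * cubicMorseInv p.2 ^ 4 * Real.sqrt (cubicMorseInv p.2 + 1 / 3) : ℝ) : ℂ) *
    f ((Real.exp p.1 * cubicMorseInv p.2) ^ 6)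

lemma morseAmplitude_eq_zero_of_notMem (f : ℝ → ℂ) (x : ℝ) {u : ℝ}
    (hu : u ∉ cubicMorse '' Set.Ioi 0) : morseAmplitude f (x, u) = 0 := by
  simp [morseAmplitude, cubicMorseInv, if_neg hu]

lemma morseAmplitude_cubicMorse (f : ℝ → ℂ) (x : ℝ) {w : ℝ} (hw : 0 < w) :
    morseAmplitude f (x, cubicMorse w) =
      ((4 * Real.exp x ^ 6 * w ^ 4 * Real.sqrt (w + 1 / 3) : ℝ) : ℂ) *
        f ((Real.exp x * w) ^ 6) := by
  rw [morseAmplitude, cubicMorseInv_leftInvOn hw]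

lemma exists_isCompact_morseAmplitude_eq_zero {f : ℝ → ℂ} (hcs : HasCompactSupport f)
    (hpos : tsupport f ⊆ Set.Ioi 0) {L : Set ℝ} (hL : IsCompact L) :
    ∃ Q ⊆ cubicMorse '' Set.Ioi 0, IsCompact Q ∧
      ∀ x ∈ L, ∀ u ∉ Q, morseAmplitude f (x, u) = 0 := by
  set T : Set ℝ := (fun p : ℝ × ℝ => p.1 ^ ((1 : ℝ) / 6) * Real.exp (-p.2)) '' (tsupport f ×ˢ L)
  have hT : IsCompact T := (hcs.isCompact.prod hL).image_of_continuousOn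
    (ContinuousOn.mul (continuousOn_fst.rpow_const fun _ _ => Or.inr (by norm_num))
      (by fun_prop))
  have hT0 : T ⊆ Set.Ioi 0 := by
    rintro _ ⟨⟨y, x⟩, ⟨hy, -⟩, rfl⟩
    have : 0 < y := hpos hy
    exact mul_pos (Real.rpow_pos_of_pos this _) (Real.exp_pos _)
  refine ⟨cubicMorse '' T, Set.image_mono hT0, hT.image_of_continuousOn fun w hw =>
    (contDiffAt_cubicMorse (hT0 hw)).continuousAt.continuousWithinAt, fun x hx u hu => ?_⟩
  by_cases hV : u ∈ cubicMorse '' Set.Ioi 0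
  · obtain ⟨w, hw, rfl⟩ := hV
    have hw0 : 0 < w := hw
    rw [morseAmplitude_cubicMorse f x hw]
    have : (Real.exp x * w) ^ 6 ∉ tsupport f := by
      refine fun h => hu ⟨w, ⟨⟨_, x⟩, ⟨h, hx⟩, ?_⟩, rfl⟩
      have h6 : ((Real.exp x * w) ^ 6) ^ ((1 : ℝ) / 6) = Real.exp x * w := by
        rw [← Real.rpow_natCast, ← Real.rpow_mul (by positivity)]; norm_num
      simp only [h6]
      rw [mul_right_comm, ← Real.exp_add]; simp
    rw [image_eq_zero_of_notMem_tsupport this, mul_zero]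
  · exact morseAmplitude_eq_zero_of_notMem f x hV

lemma contDiff_morseAmplitude {f : ℝ → ℂ} (hsm : ContDiff ℝ ∞ f) (hcs : HasCompactSupport f)
    (hpos : tsupport f ⊆ Set.Ioi 0) : ContDiff ℝ ∞ (morseAmplitude f) := by
  rw [contDiff_iff_contDiffAt]
  rintro ⟨x, u⟩
  by_cases hu : u ∈ cubicMorse '' Set.Ioi 0
  · obtain ⟨w, hw, rfl⟩ := hu
    have hw0 : 0 < w := hw
    have hr : ContDiffAt ℝ ∞ (fun p : ℝ × ℝ => cubicMorseInv p.2) (x, cubicMorse w) :=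
      (contDiffAt_cubicMorseInv hw).comp (x, cubicMorse w) contDiffAt_snd
    have he : ContDiffAt ℝ ∞ (fun p : ℝ × ℝ => Real.exp p.1) (x, cubicMorse w) := by fun_prop
    have hs : ContDiffAt ℝ ∞ (fun p : ℝ × ℝ => Real.sqrt (cubicMorseInv p.2 + 1 / 3))
        (x, cubicMorse w) := by
      refine (hr.add contDiffAt_const).sqrt ?_
      rw [cubicMorseInv_leftInvOn hw]; positivity
    refine ContDiffAt.mul (Complex.ofRealCLM.contDiff.contDiffAt.comp _
      (((contDiffAt_const.mul (he.pow 6)).mul (hr.pow 4)).mul hs)) ?_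
    exact hsm.contDiffAt.comp _ ((he.mul hr).pow 6)
  · obtain ⟨Q, hQV, hQ, hzero⟩ := exists_isCompact_morseAmplitude_eq_zero hcs hpos
      (isCompact_Icc (a := x - 1) (b := x + 1))
    refine (contDiffAt_const (c := (0 : ℂ))).congr_of_eventuallyEq ?_
    have hmem : Set.Icc (x - 1) (x + 1) ×ˢ Qᶜ ∈ 𝓝 (x, u) :=
      prod_mem_nhds (Icc_mem_nhds (by linarith) (by linarith))
        (hQ.isClosed.isOpen_compl.mem_nhds fun h => hu (hQV h))
    filter_upwards [hmem] with p hp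
    exact hzero p.1 hp.1 p.2 hp.2

lemma image_mul_pow_six_Ioi {l : ℝ} (hl : 0 < l) :
    (fun w : ℝ => (l * w) ^ 6) '' Set.Ioi 0 = Set.Ioi 0 := by
  refine Set.Subset.antisymm ?_ fun y (hy : 0 < y) =>
    ⟨y ^ ((1 : ℝ) / 6) / l, div_pos (Real.rpow_pos_of_pos hy _) hl, ?_⟩
  · rintro _ ⟨w, hw, rfl⟩
    have : 0 < w := hw
    exact pow_pos (mul_pos hl this) 6
  · simp only
    rw [mul_div_cancel₀ _ hl.ne', ← Real.rpow_natCast, ← Real.rpow_mul hy.le]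
    norm_num

lemma integral_eq_integral_morseAmplitude (f : ℝ → ℂ) {α l : ℝ} (hl : 0 < l) :
    ∫ y in Set.Ioi (0 : ℝ), f y * e (α * y ^ ((1 : ℝ) / 2) - α * l * y ^ ((1 : ℝ) / 3)) =
      e (-(4 * (α * l ^ 3) / 27)) *
        ∫ u : ℝ, e (α * l ^ 3 * u ^ 2) * morseAmplitude f (Real.log l, u) := by
  have h1 : ∫ u : ℝ, e (α * l ^ 3 * u ^ 2) * morseAmplitude f (Real.log l, u) =
      ∫ u in cubicMorse '' Set.Ioi 0, e (α * l ^ 3 * u ^ 2) * morseAmplitude f (Real.log l, u) := by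
    refine (setIntegral_eq_integral_of_forall_compl_eq_zero fun u hu => ?_).symm
    rw [morseAmplitude_eq_zero_of_notMem f _ hu, mul_zero]
  have hinj : Set.InjOn (fun w : ℝ => (l * w) ^ 6) (Set.Ioi 0) := by
    intro w hw w' hw' h
    have hw0 : 0 < w := hw
    have hw0' : 0 < w' := hw'
    exact mul_left_cancel₀ hl.ne'
      ((pow_left_inj₀ (by positivity) (by positivity) (by norm_num)).1 h)
  rw [h1, integral_image_eq_integral_abs_deriv_smul measurableSet_Ioi
    (fun w hw => (hasDerivAt_cubicMorse hw).hasDerivWithinAt) injOn_cubicMorse]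
  conv_lhs => rw [← image_mul_pow_six_Ioi hl]
  rw [integral_image_eq_integral_abs_deriv_smul measurableSet_Ioi
    (f' := fun w => 6 * (l * w) ^ 5 * l) (fun w _ => ?_) hinj, ← integral_const_mul]
  · refine setIntegral_congr_fun measurableSet_Ioi fun w (hw : 0 < w) => ?_
    have hlw : 0 < l * w := mul_pos hl hw
    have p2 : ((l * w) ^ 6) ^ ((1 : ℝ) / 2) = (l * w) ^ 3 := by
      rw [← Real.rpow_natCast, ← Real.rpow_mul hlw.le, ← Real.rpow_natCast]; norm_num
    have p3 : ((l * w) ^ 6) ^ ((1 : ℝ) / 3) = (l * w) ^ 2 := by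
      rw [← Real.rpow_natCast, ← Real.rpow_mul hlw.le, ← Real.rpow_natCast]; norm_num
    simp only [p2, p3]
    rw [morseAmplitude_cubicMorse f _ hw, Real.exp_log hl, cubicMorse_sq hw,
      abs_of_pos (deriv_cubicMorse_pos hw), abs_of_pos (by positivity)]
    have hs : Real.sqrt (w + 1 / 3) ≠ 0 := (Real.sqrt_pos.2 (by positivity)).ne'
    have hphase : α * (l * w) ^ 3 - α * l * (l * w) ^ 2 =
        -(4 * (α * l ^ 3) / 27) + α * l ^ 3 * (w ^ 3 - w ^ 2 + 4 / 27) := by ring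
    have hamp : 6 * (l * w) ^ 5 * l = 3 * w / (2 * Real.sqrt (w + 1 / 3)) *
        (4 * l ^ 6 * w ^ 4 * Real.sqrt (w + 1 / 3)) := by
      field_simp; ring
    rw [hphase, e_add, hamp, Complex.real_smul, Complex.real_smul]
    push_cast
    ring
  · refine HasDerivAt.hasDerivWithinAt ?_
    refine HasDerivAt.congr_deriv (((hasDerivAt_id w).const_mul l).pow 6) ?_
    simp

lemma morseAmplitude_zero (f : ℝ → ℂ) {l : ℝ} (hl : 0 < l) :
    morseAmplitude f (Real.log l, 0) =
      ((64 / 81 * l ^ 6 : ℝ) : ℂ) * f ((2 * l / 3) ^ 6) := by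
  have h0 : cubicMorse (2 / 3) = 0 := by simp [cubicMorse]
  rw [← h0, morseAmplitude_cubicMorse f _ (by norm_num), Real.exp_log hl]
  norm_num
  ring_nf

theorem stmt9 (f : ℝ → ℂ) (hsm : ContDiff ℝ (⊤ : ℕ∞) f) (hcs : HasCompactSupport f)
    (hpos : tsupport f ⊆ Set.Ioi 0)
    (K : Set ℝ) (hK : IsCompact K) (hKpos : K ⊆ Set.Ioi 0) :
    ∃ C > (0:ℝ), ∃ α₀ > (0:ℝ), ∀ α β : ℝ, α₀ ≤ α → β / α ∈ K →
      ‖(∫ y in Set.Ioi (0:ℝ),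
            f y * e (α * y ^ ((1:ℝ)/2) - β * y ^ ((1:ℝ)/3))) -
          ((6 * (2 * β / (3 * α)) ^ 5 / Real.sqrt (2 * β) : ℝ) : ℂ) *
            e (-(4 * β ^ 3) / (27 * α ^ 2) + 1 / 8) * f ((2 * β / (3 * α)) ^ 6)‖
        ≤ C * α ^ (-(3:ℝ)/2) := by
  have hlogK : IsCompact (Real.log '' K) := hK.image_of_continuousOn
    (Real.continuousOn_log.mono fun l hl => (hKpos hl).ne')
  have hpowK : ContinuousOn (fun l : ℝ => (l ^ 3) ^ (-(3 : ℝ) / 2)) K := fun l hl =>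
    ((continuousAt_id.pow 3).rpow_const
      (Or.inl (pow_ne_zero 3 (hKpos hl).ne'))).continuousWithinAt
  obtain ⟨B, hB⟩ := hK.exists_bound_of_continuousOn hpowK
  obtain ⟨Q, -, hQ, hzero⟩ := exists_isCompact_morseAmplitude_eq_zero hcs hpos hlogK
  obtain ⟨C, hC⟩ := exists_forall_norm_integral_e_mul_sub_le
    (contDiff_morseAmplitude hsm hcs hpos) hlogK hQ hzero
  refine ⟨max C 0 * max B 0 + 1, by positivity, 1, one_pos, fun α β hα hβ => ?_⟩
  have hα0 : 0 < α := one_pos.trans_le hα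
  obtain ⟨l, rfl⟩ : ∃ l, β = α * l := ⟨β / α, by field_simp⟩
  rw [mul_div_cancel_left₀ _ hα0.ne'] at hβ
  have hl : 0 < l := hKpos hβ
  have hm : 0 < α * l ^ 3 := by positivity
  have hmain : ((6 * (2 * (α * l) / (3 * α)) ^ 5 / Real.sqrt (2 * (α * l)) : ℝ) : ℂ) *
      e (-(4 * (α * l) ^ 3) / (27 * α ^ 2) + 1 / 8) * f ((2 * (α * l) / (3 * α)) ^ 6) =
      e (-(4 * (α * l ^ 3) / 27)) * (e (1 / 8) / Real.sqrt (2 * (α * l ^ 3)) *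
        morseAmplitude f (Real.log l, 0)) := by
    have hsq : Real.sqrt (2 * (α * l ^ 3)) = l * Real.sqrt (2 * (α * l)) := by
      rw [show 2 * (α * l ^ 3) = l ^ 2 * (2 * (α * l)) by ring, Real.sqrt_mul (by positivity),
        Real.sqrt_sq hl.le]
    have ht : 2 * (α * l) / (3 * α) = 2 * l / 3 := by field_simp
    have hp : -(4 * (α * l) ^ 3) / (27 * α ^ 2) = -(4 * (α * l ^ 3) / 27) := by field_simp
    have hs0 : (Real.sqrt (2 * (α * l)) : ℂ) ≠ 0 := by
      exact_mod_cast (Real.sqrt_pos.2 (by positivity)).ne'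
    have hl0 : (l : ℂ) ≠ 0 := by exact_mod_cast hl.ne'
    rw [morseAmplitude_zero f hl, hsq, ht, hp, e_add]
    push_cast
    field_simp
    ring
  rw [hmain, integral_eq_integral_morseAmplitude f hl, ← mul_sub, norm_mul, norm_e, one_mul]
  refine (hC _ ⟨l, hβ, rfl⟩ _ hm).trans ?_
  have hB' : (l ^ 3) ^ (-(3 : ℝ) / 2) ≤ max B 0 :=
    ((le_abs_self _).trans (hB l hβ)).trans (le_max_left _ _)
  have hlp : 0 ≤ (l ^ 3) ^ (-(3 : ℝ) / 2) := by positivity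
  have hαp : 0 ≤ α ^ (-(3 : ℝ) / 2) := by positivity
  rw [Real.mul_rpow hα0.le (by positivity)]
  calc C * (α ^ (-(3 : ℝ) / 2) * (l ^ 3) ^ (-(3 : ℝ) / 2))
      ≤ max C 0 * (α ^ (-(3 : ℝ) / 2) * max B 0) := by
        gcongr
        exact le_max_left _ _
    _ ≤ (max C 0 * max B 0 + 1) * α ^ (-(3 : ℝ) / 2) := by linarith
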